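/- Let G be a finite simple graph, k a positive integer, and e = xy an edge of G. If γ_{P,k}(G/e) = γ_{P,k}(G) − 1, then rad_{P,k}(G) ≤ rad_{P,k}(G/e), where G/e is the contraction of the edge e in G. -/

import Mathlib

open SimpleGraph

variable {V : Type*}

/-- The closed neighbourhood `N_G[v]` of a vertex. -/
def closedNbhd (G : SimpleGraph V) (v : V) : Set V := insert v (G.neighborSet v)

/-- The closed neighbourhood `N_G[X]` of a set of vertices. -/
def closedNbhdSet (G : SimpleGraph V) (X : Set V) : Set V := ⋃ v ∈ X, closedNbhd G v

/-- The sets `P^i_{G,k}(S)` of vertices monitored by `S` at step `i`. -/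
def monitored (G : SimpleGraph V) (k : ℕ) (S : Set V) : ℕ → Set V
  | 0 => closedNbhdSet G S
  | i + 1 =>
      ⋃ v ∈ {w | w ∈ monitored G k S i ∧ (closedNbhd G w \ monitored G k S i).ncard ≤ k},
        closedNbhd G v

/-- `S` is a `k`-power dominating set of `G`. -/
def IsPDS (G : SimpleGraph V) (k : ℕ) (S : Set V) : Prop :=
  ∃ i, monitored G k S i = Set.univ

/-- The `k`-power domination number `γ_{P,k}(G)`. -/
noncomputable def pdn (G : SimpleGraph V) (k : ℕ) : ℕ :=
  sInf {n | ∃ S : Set V, IsPDS G k S ∧ S.ncard = n}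

/-- The radius `rad_{P,k}(G,S)` of a `k`-PDS `S`. -/
noncomputable def radPDS (G : SimpleGraph V) (k : ℕ) (S : Set V) : ℕ :=
  1 + sInf {i | monitored G k S i = Set.univ}

/-- The `k`-propagation radius `rad_{P,k}(G)`. -/
noncomputable def propRad (G : SimpleGraph V) (k : ℕ) : ℕ :=
  sInf {r | ∃ S : Set V, IsPDS G k S ∧ S.ncard = pdn G k ∧ radPDS G k S = r}

/-- The contraction `G/e` of the edge `e = xy`: delete `x` and `y` and replace them by a
new vertex (represented by `x`) adjacent to all vertices in `(N_G(x) ∪ N_G(y)) \ {x, y}`. -/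
def contractEdge (G : SimpleGraph V) (x y : V) : SimpleGraph {u : V // u ≠ y} :=
  SimpleGraph.fromRel (fun a b =>
    ((a : V) = x ∧ (G.Adj x b ∨ G.Adj y b)) ∨ ((a : V) ≠ x ∧ (b : V) ≠ x ∧ G.Adj a b))

lemma closedNbhd_subset_monitored (G : SimpleGraph V) (k : ℕ) {S : Set V} {v : V} (hv : v ∈ S)
    (i : ℕ) : closedNbhd G v ⊆ monitored G k S i := by
  induction i with
  | zero => exact Set.subset_biUnion_of_mem hv
  | succ i ih =>
    refine Set.subset_biUnion_of_mem (u := closedNbhd G)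
      (show v ∈ {w | w ∈ monitored G k S i ∧
        (closedNbhd G w \ monitored G k S i).ncard ≤ k} from ⟨ih (Set.mem_insert _ _), ?_⟩)
    simp [Set.sdiff_eq_empty.2 ih]

lemma mem_monitored_succ {G : SimpleGraph V} {k : ℕ} {S : Set V} {i : ℕ} {u : V} :
    u ∈ monitored G k S (i + 1) ↔ ∃ w, w ∈ monitored G k S i ∧
      (closedNbhd G w \ monitored G k S i).ncard ≤ k ∧ u ∈ closedNbhd G w := by
  simp [monitored, and_assoc]

lemma mem_closedNbhd {G : SimpleGraph V} {u v : V} :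
    u ∈ closedNbhd G v ↔ u = v ∨ G.Adj v u := by
  simp [closedNbhd]

lemma contractEdge_adj_merged {G : SimpleGraph V} {x y : V} {a b : {u : V // u ≠ y}}
    (ha : (a : V) = x) :
    (contractEdge G x y).Adj a b ↔ (b : V) ≠ x ∧ (G.Adj x b ∨ G.Adj y b) := by
  subst ha
  have : a ≠ b ↔ (b : V) ≠ a := by rw [ne_comm, Ne, Subtype.ext_iff]
  simp only [contractEdge, SimpleGraph.fromRel_adj, this]
  tauto

lemma contractEdge_adj_of_ne {G : SimpleGraph V} {x y : V} {a b : {u : V // u ≠ y}}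
    (ha : (a : V) ≠ x) (hb : (b : V) ≠ x) :
    (contractEdge G x y).Adj a b ↔ G.Adj a b := by
  have : a ≠ b ↔ (a : V) ≠ b := by rw [Ne, Subtype.ext_iff]
  simp only [contractEdge, SimpleGraph.fromRel_adj, this, G.adj_comm b a]
  have := @SimpleGraph.Adj.ne _ G a b
  tauto

/-- Vertices monitored in `G/xy` from `T` are monitored in `G`, at the same step, from any set
containing `T` and `x`, and also `y` when `T` contains the contracted vertex. -/
lemma mem_monitored_of_contractEdge [Finite V] {G : SimpleGraph V} {k : ℕ} {x y : V}
    (hxy : G.Adj x y) {T : Set {u : V // u ≠ y}} {S : Set V} (hTS : Subtype.val '' T ⊆ S)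
    (hx : x ∈ S) (hy : (⟨x, hxy.ne⟩ : {u : V // u ≠ y}) ∈ T → y ∈ S) (i : ℕ)
    {u : {u : V // u ≠ y}} (hu : u ∈ monitored (contractEdge G x y) k T i) :
    (u : V) ∈ monitored G k S i := by
  have hN := fun i => closedNbhd_subset_monitored G k hx i
  have hxi : ∀ i, x ∈ monitored G k S i := fun i => hN i (mem_closedNbhd.2 (.inl rfl))
  have hyi : ∀ i, y ∈ monitored G k S i := fun i => hN i (mem_closedNbhd.2 (.inr hxy))
  induction i generalizing u with
  | zero =>
    obtain ⟨w, hw, huw⟩ : ∃ w ∈ T, u ∈ closedNbhd (contractEdge G x y) w := by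
      simpa [monitored, closedNbhdSet] using hu
    have hwS : (w : V) ∈ S := hTS ⟨w, hw, rfl⟩
    by_cases hux : (u : V) = x
    · exact hux ▸ hxi 0
    rcases mem_closedNbhd.1 huw with rfl | hadj
    · exact closedNbhd_subset_monitored G k hwS 0 (mem_closedNbhd.2 (.inl rfl))
    by_cases hwx : (w : V) = x
    · rcases ((contractEdge_adj_merged hwx).1 hadj).2 with h | h
      · exact hN 0 (mem_closedNbhd.2 (.inr h))
      · have hyS : y ∈ S := hy (by convert hw; exact hwx.symm)
        exact closedNbhd_subset_monitored G k hyS 0 (mem_closedNbhd.2 (.inr h))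
    · exact closedNbhd_subset_monitored G k hwS 0
        (mem_closedNbhd.2 (.inr ((contractEdge_adj_of_ne hwx hux).1 hadj)))
  | succ i ih =>
    obtain ⟨w, hw, hcard, huw⟩ := mem_monitored_succ.1 hu
    have key : ∀ v : V, (∀ z : {u : V // u ≠ y}, (z : V) ≠ x → (z : V) ∈ closedNbhd G v →
          z ∈ closedNbhd (contractEdge G x y) w) →
        (closedNbhd G v \ monitored G k S i).ncard ≤ k := by
      intro v hv
      have hsub : closedNbhd G v \ monitored G k S i ⊆ Subtype.val ''
          (closedNbhd (contractEdge G x y) w \ monitored (contractEdge G x y) k T i) := by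
        rintro z ⟨hz, hzi⟩
        have hzy : z ≠ y := fun h => hzi (h ▸ hyi i)
        have hzx : z ≠ x := fun h => hzi (h ▸ hxi i)
        exact ⟨⟨z, hzy⟩, ⟨hv ⟨z, hzy⟩ hzx hz, fun h => hzi (ih h)⟩, rfl⟩
      exact (Set.ncard_le_ncard hsub (Set.toFinite _)).trans
        ((Set.ncard_image_le (Set.toFinite _)).trans hcard)
    by_cases hux : (u : V) = x
    · exact hux ▸ hxi (i + 1)
    by_cases hwx : (w : V) = x
    · have hadj : (contractEdge G x y).Adj w u :=
        (mem_closedNbhd.1 huw).resolve_left fun h => hux (h ▸ hwx)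
      rcases ((contractEdge_adj_merged hwx).1 hadj).2 with h | h
      · exact hN (i + 1) (mem_closedNbhd.2 (.inr h))
      · refine mem_monitored_succ.2 ⟨y, hyi i, key y fun z hzx hz => ?_, mem_closedNbhd.2 (.inr h)⟩
        exact mem_closedNbhd.2 (.inr ((contractEdge_adj_merged hwx).2
          ⟨hzx, .inr ((mem_closedNbhd.1 hz).resolve_left z.2)⟩))
    · refine mem_monitored_succ.2 ⟨w, ih hw, key w fun z hzx hz => ?_, ?_⟩
      · exact mem_closedNbhd.2 ((mem_closedNbhd.1 hz).imp Subtype.ext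
          (contractEdge_adj_of_ne hwx hzx).2)
      · exact mem_closedNbhd.2 ((mem_closedNbhd.1 huw).imp (congrArg Subtype.val)
          (contractEdge_adj_of_ne hwx hux).1)

lemma isPDS_univ (G : SimpleGraph V) (k : ℕ) : IsPDS G k Set.univ :=
  ⟨0, Set.eq_univ_of_forall fun v =>
    closedNbhd_subset_monitored G k (Set.mem_univ v) 0 (mem_closedNbhd.2 (.inl rfl))⟩

lemma exists_isPDS_radPDS_eq_propRad (G : SimpleGraph V) (k : ℕ) :
    ∃ S : Set V, IsPDS G k S ∧ S.ncard = pdn G k ∧ radPDS G k S = propRad G k := by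
  obtain ⟨S, hS, hcard⟩ : pdn G k ∈ {n | ∃ S : Set V, IsPDS G k S ∧ S.ncard = n} :=
    Nat.sInf_mem ⟨_, Set.univ, isPDS_univ G k, rfl⟩
  exact Nat.sInf_mem (s := {r | ∃ S : Set V, IsPDS G k S ∧ S.ncard = pdn G k ∧
    radPDS G k S = r}) ⟨_, S, hS, hcard, rfl⟩

theorem propRad_edge_contraction_decrease {V : Type*} [Fintype V] [DecidableEq V]
    (G : SimpleGraph V) (k : ℕ) (hk : 0 < k) (x y : V) (hxy : G.Adj x y)
    (h : pdn (contractEdge G x y) k + 1 = pdn G k) :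
    propRad G k ≤ propRad (contractEdge G x y) k := by
  obtain ⟨T, hT, hTcard, hTrad⟩ := exists_isPDS_radPDS_eq_propRad (contractEdge G x y) k
  obtain ⟨S, hTS, hx, hy, hScard⟩ : ∃ S : Set V, Subtype.val '' T ⊆ S ∧ x ∈ S ∧
      ((⟨x, hxy.ne⟩ : {u : V // u ≠ y}) ∈ T → y ∈ S) ∧ S.ncard = T.ncard + 1 := by
    have himg : (Subtype.val '' T).ncard = T.ncard :=
      Set.ncard_image_of_injective T Subtype.val_injective
    by_cases hxT : (⟨x, hxy.ne⟩ : {u : V // u ≠ y}) ∈ T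
    · refine ⟨insert y (Subtype.val '' T), Set.subset_insert _ _,
        .inr ⟨_, hxT, rfl⟩, fun _ => .inl rfl, ?_⟩
      rw [Set.ncard_insert_of_notMem (by simp) (Set.toFinite _), himg]
    · refine ⟨insert x (Subtype.val '' T), Set.subset_insert _ _, .inl rfl,
        fun h => absurd h hxT, ?_⟩
      rw [Set.ncard_insert_of_notMem _ (Set.toFinite _), himg]
      rintro ⟨z, hz, rfl⟩
      exact hxT hz
  have huniv : ∀ i, monitored (contractEdge G x y) k T i = Set.univ →
      monitored G k S i = Set.univ := by
    refine fun i hi => Set.eq_univ_of_forall fun v => ?_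
    by_cases hv : v = y
    · exact hv ▸ closedNbhd_subset_monitored G k hx i (mem_closedNbhd.2 (.inr hxy))
    · exact mem_monitored_of_contractEdge hxy hTS hx hy i (u := ⟨v, hv⟩) (hi ▸ Set.mem_univ _)
  have hrad : radPDS G k S ≤ radPDS (contractEdge G x y) k T :=
    Nat.add_le_add_left (Nat.sInf_le (huniv _ (Nat.sInf_mem hT))) 1
  rw [← hTrad]
  refine le_trans (Nat.sInf_le ⟨S, hT.imp huniv, ?_, rfl⟩) hrad
  rw [hScard, hTcard, h]
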